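/- arXiv:2502.19030 — 2 statements merged into one kernel-verified Lean document; each statement's English description precedes it below -/
import Mathlib

section
/- (Lemma 2, doubly-stochastic property) Let H be a hypergraph with incidence matrix B = (b_{i,α}) such that every hyperedge has size s_α ≥ 2. Then every column of the transition matrix U of the non-backtracking higher-order random walk sums to 1 over the state space: for every (j,β) ∈ ℰ, Σ_{(i,α) ∈ ℰ} U_{(i,α),(j,β)} = 1. -/
open scoped Classical

/-- Lemma 2 (doubly-stochastic property): every column of the NB-HO-RW
transition matrix `U` sums to 1 over the state space. The hypergraph is
given by a 0/1 incidence matrix `b`, with node degrees `d i = ∑ α, b i α`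
and hyperedge sizes `s α = ∑ i, b i α`, every hyperedge having size `≥ 2`.
The state space is `ℰ = {(i, α) : b i α = 1}`, and for states
`p = (i, α)`, `q = (j, β)`:
`U p q = b j α * 1[i ≠ j ∧ α = β] / (s α - 1)` if `d j = 1`, and
`U p q = b j α * 1[i ≠ j ∧ α ≠ β] / ((d j - 1) * (s α - 1))` if `d j > 1`.
Then for every `(j, β) ∈ ℰ`, `∑ (i, α) ∈ ℰ, U (i, α) (j, β) = 1`. -/
theorem nb_ho_rw_column_sum_one
    (n m : ℕ) (b : Fin n → Fin m → ℝ)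
    (hb : ∀ i α, b i α = 0 ∨ b i α = 1)
    (d : Fin n → ℝ) (hd : ∀ i, d i = ∑ α, b i α)
    (s : Fin m → ℝ) (hs : ∀ α, s α = ∑ i, b i α)
    (hs2 : ∀ α, 2 ≤ s α)
    (E : Finset (Fin n × Fin m))
    (hE : E = Finset.univ.filter fun p => b p.1 p.2 = 1)
    (U : Fin n × Fin m → Fin n × Fin m → ℝ)
    (hU1 : ∀ p q, d q.1 = 1 →
      U p q = b q.1 p.2 * (if p.1 ≠ q.1 ∧ p.2 = q.2 then 1 else 0)
        / (s p.2 - 1))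
    (hU2 : ∀ p q, 1 < d q.1 →
      U p q = b q.1 p.2 * (if p.1 ≠ q.1 ∧ p.2 ≠ q.2 then 1 else 0)
        / ((d q.1 - 1) * (s p.2 - 1)))
    (j : Fin n) (β : Fin m) (hjβ : (j, β) ∈ E) :
    ∑ p ∈ E, U p (j, β) = 1 := by
  have hjb : b j β = 1 := by
    rw [hE] at hjβ
    simpa using hjβ
  have hsum : ∀ f : Fin n × Fin m → ℝ, ∑ p ∈ E, f p = ∑ α, ∑ i, b i α * f (i, α) := by
    intro f
    rw [hE, Finset.sum_filter, Fintype.sum_prod_type, Finset.sum_comm]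
    refine Finset.sum_congr rfl fun α _ => Finset.sum_congr rfl fun i _ => ?_
    rcases hb i α with h | h <;> simp [h]
  have hne : ∀ α, ∑ i, b i α * (if i ≠ j then (1 : ℝ) else 0) = s α - b j α := by
    intro α
    have h : ∀ i, b i α * (if i ≠ j then (1 : ℝ) else 0)
        = b i α - (if i = j then b i α else 0) := by
      intro i
      by_cases h : i = j <;> simp [h]
    simp only [h, Finset.sum_sub_distrib, ← hs]
    simp
  have key : ∀ (α : Fin m) (x c : ℝ),
      ∑ i, b i α * (b j α * ((if i ≠ j then (1 : ℝ) else 0) * x) / (c * (s α - 1)))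
        = b j α * x / c := by
    intro α x c
    have h : ∀ i, b i α * (b j α * ((if i ≠ j then (1 : ℝ) else 0) * x) / (c * (s α - 1)))
        = (b i α * (if i ≠ j then (1 : ℝ) else 0)) * (b j α * x / c / (s α - 1)) := by
      intro i
      rw [← div_div]
      ring
    simp only [h]
    rw [← Finset.sum_mul, hne]
    rcases hb j α with h0 | h0
    · simp [h0]
    · have : s α - 1 ≠ 0 := by linarith [hs2 α]
      rw [h0]
      exact mul_div_cancel₀ _ this
  have hd1 : 1 ≤ d j := by
    rw [hd, ← hjb]
    refine Finset.single_le_sum (f := fun α => b j α) (fun α _ => ?_) (Finset.mem_univ β)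
    rcases hb j α with h | h <;> simp [h]
  rw [hsum]
  rcases hd1.eq_or_lt with h1 | h1
  · have h : ∀ α, ∑ i, b i α * U (i, α) (j, β) = b j α * (if α = β then 1 else 0) / 1 := by
      intro α
      rw [← key α]
      refine Finset.sum_congr rfl fun i _ => ?_
      rw [hU1 _ _ h1.symm, one_mul]
      by_cases hi : i = j <;> by_cases ha : α = β <;> simp [hi, ha]
    simp only [h]
    simp [hjb]
  · have h : ∀ α, ∑ i, b i α * U (i, α) (j, β)
        = b j α * (if α ≠ β then 1 else 0) / (d j - 1) := by
      intro α
      rw [← key α]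
      refine Finset.sum_congr rfl fun i _ => ?_
      rw [hU2 _ _ h1]
      by_cases hi : i = j <;> by_cases ha : α = β <;> simp [hi, ha]
    have h' : ∀ α, b j α * (if α ≠ β then (1 : ℝ) else 0)
        = b j α - (if α = β then b j α else 0) := by
      intro α
      by_cases h : α = β <;> simp [h]
    simp only [h]
    rw [← Finset.sum_div]
    simp only [h', Finset.sum_sub_distrib, ← hd]
    have : d j - 1 ≠ 0 := by linarith
    simp [hjb, this]
end

section
/- (Lemma 2, stationarity of the uniform distribution) Let H be a hypergraph with incidence matrix B = (b_{i,α}) such that every hyperedge has size s_α ≥ 2, and let D = |ℰ| where ℰ = {(i,α) : b_{i,α} = 1}, with D ≥ 1. Then the uniform distribution π_ℰ = (1/D)_{(i,α)∈ℰ} is a stationary distribution of the non-backtracking higher-order random walk: for every (j,β) ∈ ℰ, Σ_{(i,α) ∈ ℰ} (1/D) · U_{(i,α),(j,β)} = 1/D. -/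
open scoped Classical

/-- Lemma 2 (stationarity of the uniform distribution): the uniform
distribution `π = (1/D)` on the state space `ℰ = {(i, α) : b i α = 1}`,
where `D = |ℰ| ≥ 1`, is stationary for the NB-HO-RW transition matrix `U`.
The hypergraph is given by a 0/1 incidence matrix `b`, with node degrees
`d i = ∑ α, b i α` and hyperedge sizes `s α = ∑ i, b i α`, every hyperedge
having size `≥ 2`. For states `p = (i, α)`, `q = (j, β)`:
`U p q = b j α * 1[i ≠ j ∧ α = β] / (s α - 1)` if `d j = 1`, and
`U p q = b j α * 1[i ≠ j ∧ α ≠ β] / ((d j - 1) * (s α - 1))` if `d j > 1`.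
Then for every `(j, β) ∈ ℰ`, `∑ (i, α) ∈ ℰ, (1/D) * U (i, α) (j, β) = 1/D`. -/
theorem nb_ho_rw_uniform_stationary
    (n m : ℕ) (b : Fin n → Fin m → ℝ)
    (hb : ∀ i α, b i α = 0 ∨ b i α = 1)
    (d : Fin n → ℝ) (hd : ∀ i, d i = ∑ α, b i α)
    (s : Fin m → ℝ) (hs : ∀ α, s α = ∑ i, b i α)
    (hs2 : ∀ α, 2 ≤ s α)
    (E : Finset (Fin n × Fin m))
    (hE : E = Finset.univ.filter fun p => b p.1 p.2 = 1)
    (D : ℕ) (hD : D = E.card) (hD1 : 1 ≤ D)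
    (U : Fin n × Fin m → Fin n × Fin m → ℝ)
    (hU1 : ∀ p q, d q.1 = 1 →
      U p q = b q.1 p.2 * (if p.1 ≠ q.1 ∧ p.2 = q.2 then 1 else 0)
        / (s p.2 - 1))
    (hU2 : ∀ p q, 1 < d q.1 →
      U p q = b q.1 p.2 * (if p.1 ≠ q.1 ∧ p.2 ≠ q.2 then 1 else 0)
        / ((d q.1 - 1) * (s p.2 - 1)))
    (j : Fin n) (β : Fin m) (hjβ : (j, β) ∈ E) :
    ∑ p ∈ E, (1 / (D : ℝ)) * U p (j, β) = 1 / (D : ℝ) := by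
  have hbj : b j β = 1 := by
    rw [hE] at hjβ
    simpa using hjβ
  have hdj : 1 ≤ d j := by
    rw [hd j, ← hbj]
    refine Finset.single_le_sum (f := fun α => b j α) (fun α _ => ?_) (Finset.mem_univ β)
    rcases hb j α with h | h <;> simp [h]
  have key : ∀ α, ∑ i, b i α * (if i ≠ j then (1 : ℝ) else 0) = s α - b j α := by
    intro α
    rw [hs α, eq_sub_iff_add_eq]
    have h1 : b j α = ∑ i, (if i = j then b i α else 0) := by simp
    rw [h1, ← Finset.sum_add_distrib]
    refine Finset.sum_congr rfl fun i _ => ?_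
    by_cases h : i = j <;> simp [h]
  have main : ∀ c : Fin m → ℝ,
      (∀ i α, U (i, α) (j, β) = (if i ≠ j then (1 : ℝ) else 0) * (b j α * c α / (s α - 1))) →
      ∑ α, b j α * c α = 1 → ∑ p ∈ E, U p (j, β) = 1 := by
    intro c hc hsum
    have h1 : ∑ p ∈ E, U p (j, β) = ∑ p : Fin n × Fin m, b p.1 p.2 * U p (j, β) := by
      rw [hE, Finset.sum_filter]
      refine Finset.sum_congr rfl fun p _ => ?_
      rcases hb p.1 p.2 with h | h <;> simp [h]
    rw [h1, Fintype.sum_prod_type_right, ← hsum]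
    refine Finset.sum_congr rfl fun α _ => ?_
    simp only [hc]
    simp_rw [← mul_assoc]
    rw [← Finset.sum_mul, key α]
    have h2 : s α - 1 ≠ 0 := by linarith [hs2 α]
    rcases hb j α with h | h
    · simp [h]
    · rw [h]
      field_simp
  have hU : ∑ p ∈ E, U p (j, β) = 1 := by
    rcases hdj.eq_or_lt with h | h
    · refine main (fun α => if α = β then 1 else 0) (fun i α => ?_) (by simp [hbj])
      rw [hU1 _ _ h.symm]
      by_cases h1 : i = j <;> by_cases h2 : α = β <;> simp [h1, h2]
    · have h0 : d j - 1 ≠ 0 := by linarith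
      refine main (fun α => (if α ≠ β then 1 else 0) / (d j - 1)) (fun i α => ?_) ?_
      · rw [hU2 _ _ h]
        by_cases h1 : i = j <;> by_cases h2 : α = β <;> simp [h1, h2, div_eq_mul_inv] <;> ring
      · simp_rw [← mul_div_assoc]
        rw [← Finset.sum_div, div_eq_one_iff_eq h0, eq_sub_iff_add_eq, hd j]
        have h1 : (1 : ℝ) = ∑ α, (if α = β then b j α else 0) := by simp [hbj]
        nth_rewrite 2 [h1]
        rw [← Finset.sum_add_distrib]
        refine Finset.sum_congr rfl fun α _ => ?_
        by_cases h : α = β <;> simp [h]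
  rw [← Finset.mul_sum, hU, mul_one]
end
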